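/- arXiv:2002.02844 — 2 statements merged into one kernel-verified Lean document; each statement's English description precedes it below -/
import Mathlib

section
/- There exists a universal constant C > 0 such that for every positive integer n, every symmetric matrix A ∈ ℝ^{n×n} with tr(A) = 0, every real t > 0, and every integer l ≥ 2, if σ is uniformly distributed on {-1, +1}^n then P( |σᵀ A σ| > t ) ≤ t^{-l} · C^l · max{ √l · ‖A‖_F , l · ‖A‖₂ }^l. -/
/-- The Frobenius norm `‖B‖_F = sqrt (Σ_{i,j} B i j ^ 2)` of a real square matrix. -/
noncomputable def frobNorm {n : ℕ} (B : Matrix (Fin n) (Fin n) ℝ) : ℝ :=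
  Real.sqrt (∑ i, ∑ j, (B i j) ^ 2)

/-- The spectral norm `‖B‖₂ = sup_{‖x‖₂ = 1} ‖Bx‖₂` of a real square matrix, i.e. the
operator norm of the induced map on Euclidean space. -/
noncomputable def specNorm {n : ℕ} (B : Matrix (Fin n) (Fin n) ℝ) : ℝ :=
  ‖LinearMap.toContinuousLinearMap (Matrix.toEuclideanLin B)‖


namespace Chaos

/-- sign -/
def sg (x : Bool) : ℝ := if x then 1 else -1

lemma sg_sq (x : Bool) : sg x * sg x = 1 := by cases x <;> norm_num [sg]

lemma sg_not (x : Bool) : sg (!x) = - sg x := by cases x <;> norm_num [sg]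

/-- sign vector -/
def sv {n : ℕ} (b : Fin n → Bool) : Fin n → ℝ := fun i => sg (b i)

/-- sum of squares -/
def q {n : ℕ} (x : Fin n → ℝ) : ℝ := ∑ i, x i ^ 2

/-- squared Frobenius norm -/
def fr {n : ℕ} (M : Matrix (Fin n) (Fin n) ℝ) : ℝ := ∑ i, ∑ j, M i j ^ 2

/-- squared operator norm bound -/
def OpB {n : ℕ} (M : Matrix (Fin n) (Fin n) ℝ) (c : ℝ) : Prop :=
  ∀ x : Fin n → ℝ, q (M.mulVec x) ≤ c * q x

/-- quadratic form -/
def quad {n : ℕ} (M : Matrix (Fin n) (Fin n) ℝ) (x : Fin n → ℝ) : ℝ :=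
  ∑ i, ∑ j, x i * M i j * x j

/-- 0/1 indicator -/
def ind (x : Bool) : ℝ := if x then 1 else 0

/-- rows in δ, columns outside δ -/
def mask {n : ℕ} (δ : Fin n → Bool) (M : Matrix (Fin n) (Fin n) ℝ) :
    Matrix (Fin n) (Fin n) ℝ := fun i j => ind (δ i) * ind (!δ j) * M i j

lemma q_nonneg {n : ℕ} (x : Fin n → ℝ) : 0 ≤ q x :=
  Finset.sum_nonneg fun _ _ => sq_nonneg _

lemma fr_nonneg {n : ℕ} (M : Matrix (Fin n) (Fin n) ℝ) : 0 ≤ fr M :=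
  Finset.sum_nonneg fun _ _ => Finset.sum_nonneg fun _ _ => sq_nonneg _

lemma ind_sq_le (x : Bool) (a : ℝ) : (ind x * a) ^ 2 ≤ a ^ 2 := by
  cases x <;> simp [ind, sq_nonneg]

lemma OpB.mask {n : ℕ} {M : Matrix (Fin n) (Fin n) ℝ} {c : ℝ} (hc : 0 ≤ c) (h : OpB M c)
    (δ : Fin n → Bool) : OpB (mask δ M) c := by
  intro x
  have h1 : ∀ i, (Chaos.mask δ M).mulVec x i
      = ind (δ i) * M.mulVec (fun j => ind (!δ j) * x j) i := by
    intro i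
    simp only [Matrix.mulVec, dotProduct, Chaos.mask, Finset.mul_sum]
    exact Finset.sum_congr rfl fun j _ => by ring
  calc q ((Chaos.mask δ M).mulVec x)
      ≤ q (M.mulVec (fun j => ind (!δ j) * x j)) := by
        unfold q
        refine Finset.sum_le_sum fun i _ => ?_
        rw [h1]; exact ind_sq_le _ _
    _ ≤ c * q (fun j => ind (!δ j) * x j) := h _
    _ ≤ c * q x := by
        refine mul_le_mul_of_nonneg_left ?_ hc
        exact Finset.sum_le_sum fun i _ => ind_sq_le _ _

lemma fr_mask {n : ℕ} (M : Matrix (Fin n) (Fin n) ℝ) (δ : Fin n → Bool) :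
    fr (mask δ M) ≤ fr M := by
  refine Finset.sum_le_sum fun i _ => Finset.sum_le_sum fun j _ => ?_
  unfold mask
  rw [mul_assoc]
  exact (ind_sq_le _ _).trans (ind_sq_le _ _)

lemma q_eq_dot {n : ℕ} (x : Fin n → ℝ) : q x = x ⬝ᵥ x := by
  simp [q, dotProduct, sq]

lemma OpB.transpose {n : ℕ} {M : Matrix (Fin n) (Fin n) ℝ} {c : ℝ} (h : OpB M c) :
    OpB M.transpose c := by
  intro y
  set z := M.transpose.mulVec y with hz
  have h1 : q z = y ⬝ᵥ (M.mulVec z) := by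
    rw [Matrix.dotProduct_mulVec, ← Matrix.mulVec_transpose, ← hz, q_eq_dot]
  have h2 : (q z) ^ 2 ≤ q y * q (M.mulVec z) := by
    rw [h1]
    exact Finset.sum_mul_sq_le_sq_mul_sq _ _ _
  have h3 := h z
  rcases (q_nonneg z).eq_or_lt with h0 | h0
  · rw [← h0]
    by_cases hy : q y = 0
    · rw [hy]; simp
    · have hy' : 0 < q y := lt_of_le_of_ne (q_nonneg y) (Ne.symm hy)
      have := h y
      have : 0 ≤ c * q y := (q_nonneg _).trans this
      exact this
  · have h4 : q y * q (M.mulVec z) ≤ q y * (c * q z) :=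
      mul_le_mul_of_nonneg_left h3 (q_nonneg y)
    nlinarith

/-- 8 MᵀM -/
def gram {n : ℕ} (M : Matrix (Fin n) (Fin n) ℝ) : Matrix (Fin n) (Fin n) ℝ :=
  (8 : ℝ) • (M.transpose * M)

lemma q_smul {n : ℕ} (a : ℝ) (x : Fin n → ℝ) : q (a • x) = a ^ 2 * q x := by
  simp [q, Finset.mul_sum, mul_pow]

lemma OpB.gram {n : ℕ} {M : Matrix (Fin n) (Fin n) ℝ} {c : ℝ} (hc : 0 ≤ c) (h : OpB M c) :
    OpB (gram M) (64 * c ^ 2) := by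
  intro x
  unfold Chaos.gram
  rw [Matrix.smul_mulVec, q_smul, ← Matrix.mulVec_mulVec]
  have h1 := h.transpose (M.mulVec x)
  have h2 := mul_le_mul_of_nonneg_left (h x) hc
  nlinarith

lemma fr_col {n : ℕ} (M : Matrix (Fin n) (Fin n) ℝ) :
    fr M = ∑ j, q (fun i => M i j) := by
  unfold fr q
  exact Finset.sum_comm

lemma fr_gram {n : ℕ} {M : Matrix (Fin n) (Fin n) ℝ} {c : ℝ} (h : OpB M c) :
    fr (gram M) ≤ 64 * c * fr M := by
  rw [fr_col, fr_col, Finset.mul_sum]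
  refine Finset.sum_le_sum fun j _ => ?_
  have h1 : (fun i => gram M i j) = (8 : ℝ) • M.transpose.mulVec (fun i => M i j) := by
    ext i
    simp [gram, Matrix.mul_apply, Matrix.mulVec, dotProduct]
  rw [h1, q_smul]
  have := h.transpose (fun i => M i j)
  nlinarith

lemma trace_gram {n : ℕ} (M : Matrix (Fin n) (Fin n) ℝ) :
    (gram M).trace = 8 * fr M := by
  rw [fr_col]
  simp [gram, Matrix.trace, Matrix.mul_apply, q, sq, Finset.mul_sum]

lemma quad_gram {n : ℕ} (M : Matrix (Fin n) (Fin n) ℝ) (x : Fin n → ℝ) :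
    quad (gram M) x = 8 * q (M.mulVec x) := by
  have h : quad (gram M) x = x ⬝ᵥ (gram M).mulVec x := by
    simp [quad, dotProduct, Matrix.mulVec, Finset.mul_sum, mul_assoc]
  rw [h, gram, Matrix.smul_mulVec, dotProduct_smul, ← Matrix.mulVec_mulVec, q_eq_dot,
    Matrix.dotProduct_mulVec, ← Matrix.mulVec_transpose, Matrix.transpose_transpose, smul_eq_mul]

/-- mgf of a Rademacher sum -/
lemma rad_mgf {n : ℕ} (v : Fin n → ℝ) :
    ∑ b : Fin n → Bool, Real.exp (∑ i, sv b i * v i) ≤ 2 ^ n * Real.exp (q v / 2) := by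
  have h1 : ∑ b : Fin n → Bool, Real.exp (∑ i, sv b i * v i)
      = ∏ i, ∑ x : Bool, Real.exp (sg x * v i) := by
    rw [Finset.prod_univ_sum, Fintype.piFinset_univ]
    exact Finset.sum_congr rfl fun b _ => by rw [Real.exp_sum]; rfl
  have h2 : 2 ^ n * Real.exp (q v / 2) = ∏ i, 2 * Real.exp (v i ^ 2 / 2) := by
    rw [Finset.prod_mul_distrib, ← Real.exp_sum]
    simp [q, Finset.sum_div]
  rw [h1, h2]
  refine Finset.prod_le_prod (fun i _ => Finset.sum_nonneg fun _ _ => (Real.exp_pos _).le) ?_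
  intro i _
  have := Real.cosh_le_exp_half_sq (v i)
  rw [Real.cosh_eq] at this
  simp [sg]
  linarith

/-- merge two sign patterns -/
def merge {n : ℕ} (δ b b' : Fin n → Bool) : Fin n → Bool :=
  fun i => if δ i then b' i else b i

lemma sum_merge {n : ℕ} (δ : Fin n → Bool) (g : (Fin n → Bool) → ℝ) :
    ∑ b, ∑ b', g (merge δ b b') = 2 ^ n * ∑ b, g b := by
  have hinv : Function.Involutive
      (fun p : (Fin n → Bool) × (Fin n → Bool) => (merge δ p.1 p.2, merge δ p.2 p.1)) := by
    rintro ⟨b, b'⟩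
    ext i <;> cases h : δ i <;> simp [merge, h]
  have h := Equiv.sum_comp hinv.toPerm
    (fun p : (Fin n → Bool) × (Fin n → Bool) => g p.1)
  rw [Fintype.sum_prod_type, Fintype.sum_prod_type] at h
  simp only [Function.Involutive.coe_toPerm] at h
  rw [h]
  simp [Finset.mul_sum]

lemma quad_mask_merge {n : ℕ} (A : Matrix (Fin n) (Fin n) ℝ) (δ b b' : Fin n → Bool) :
    quad (mask δ A) (sv (merge δ b b')) = ∑ i, sv b' i * (mask δ A).mulVec (sv b) i := by
  unfold quad
  refine Finset.sum_congr rfl fun i _ => ?_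
  simp only [Matrix.mulVec, dotProduct, Finset.mul_sum]
  refine Finset.sum_congr rfl fun j _ => ?_
  cases hi : δ i <;> cases hj : δ j <;> simp [mask, ind, sv, merge, hi, hj, mul_assoc]

lemma decouple_fixed {n : ℕ} (A : Matrix (Fin n) (Fin n) ℝ) (δ : Fin n → Bool) :
    ∑ b : Fin n → Bool, Real.exp (4 * quad (mask δ A) (sv b))
      ≤ ∑ b : Fin n → Bool, Real.exp (8 * q ((mask δ A).mulVec (sv b))) := by
  have h := sum_merge δ (fun b => Real.exp (4 * quad (mask δ A) (sv b)))
  have hp : (0 : ℝ) < 2 ^ n := by positivity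
  refine le_of_mul_le_mul_left ?_ hp
  rw [← h, Finset.mul_sum]
  refine Finset.sum_le_sum fun b _ => ?_
  have h2 := rad_mgf ((4 : ℝ) • (mask δ A).mulVec (sv b))
  rw [q_smul] at h2
  have e1 : (4 : ℝ) ^ 2 * q ((mask δ A).mulVec (sv b)) / 2
      = 8 * q ((mask δ A).mulVec (sv b)) := by ring
  rw [e1] at h2
  refine le_trans (le_of_eq ?_) h2
  refine Finset.sum_congr rfl fun b' _ => ?_
  rw [quad_mask_merge, Finset.mul_sum]
  congr 1
  exact Finset.sum_congr rfl fun i _ => by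
    rw [Pi.smul_apply, smul_eq_mul]; ring

lemma sum_flip {n : ℕ} (i : Fin n) (g : (Fin n → Bool) → ℝ)
    (hg : ∀ b, g (Function.update b i (!b i)) = - g b) : ∑ b, g b = 0 := by
  have hinv : Function.Involutive
      (fun b : Fin n → Bool => Function.update b i (!b i)) := by
    intro b
    simp
  have h := Equiv.sum_comp hinv.toPerm g
  simp only [Function.Involutive.coe_toPerm, hg, Finset.sum_neg_distrib] at h
  linarith

lemma sum_ind {n : ℕ} (i j : Fin n) :
    ∑ δ : Fin n → Bool, 4 * (ind (δ i) * ind (!δ j)) = if i = j then 0 else 2 ^ n := by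
  split_ifs with hij
  · subst hij
    refine Finset.sum_eq_zero fun δ _ => ?_
    cases δ i <;> simp [ind]
  · have e : ∀ δ : Fin n → Bool, 4 * (ind (δ i) * ind (!δ j))
        = 1 + sg (δ i) - sg (δ j) - sg (δ i) * sg (δ j) := by
      intro δ
      cases δ i <;> cases δ j <;> norm_num [ind, sg]
    have h1 : ∀ k : Fin n, ∑ δ : Fin n → Bool, sg (δ k) = 0 := fun k =>
      sum_flip k _ fun b => by simp [sg_not]
    have h2 : ∑ δ : Fin n → Bool, sg (δ i) * sg (δ j) = 0 :=
      sum_flip i _ fun b => by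
        rw [Function.update_self, Function.update_of_ne (Ne.symm hij), sg_not]; ring
    simp only [e, Finset.sum_sub_distrib, Finset.sum_add_distrib, h1, h2]
    simp

lemma quad_avg {n : ℕ} (A : Matrix (Fin n) (Fin n) ℝ) (b : Fin n → Bool) :
    ∑ δ : Fin n → Bool, 4 * quad (mask δ A) (sv b) = 2 ^ n * (quad A (sv b) - A.trace) := by
  have h1 : ∑ δ : Fin n → Bool, 4 * quad (mask δ A) (sv b)
      = ∑ i, ∑ j, (∑ δ : Fin n → Bool, 4 * (ind (δ i) * ind (!δ j)))
          * (sv b i * A i j * sv b j) := by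
    simp only [quad, Finset.mul_sum, Finset.sum_mul]
    rw [Finset.sum_comm]
    refine Finset.sum_congr rfl fun i _ => ?_
    rw [Finset.sum_comm]
    refine Finset.sum_congr rfl fun j _ => ?_
    refine Finset.sum_congr rfl fun δ _ => ?_
    unfold mask
    ring
  have h2 : A.trace = ∑ i, ∑ j, if i = j then sv b i * A i j * sv b j else 0 := by
    simp only [Finset.sum_ite_eq, Finset.mem_univ, if_true, Matrix.trace, Matrix.diag]
    refine Finset.sum_congr rfl fun i _ => ?_
    have := sg_sq (b i)
    unfold sv
    linear_combination (- A i i) * this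
  rw [h1, h2, quad, ← Finset.sum_sub_distrib, Finset.mul_sum]
  refine Finset.sum_congr rfl fun i _ => ?_
  rw [← Finset.sum_sub_distrib, Finset.mul_sum]
  refine Finset.sum_congr rfl fun j _ => ?_
  rw [sum_ind]
  split_ifs <;> ring

lemma jensen {n : ℕ} (f : (Fin n → Bool) → ℝ) (m : ℝ) (h : ∑ δ, f δ = 2 ^ n * m) :
    2 ^ n * Real.exp m ≤ ∑ δ, Real.exp (f δ) := by
  have h1 : ∀ δ, Real.exp m * (f δ - m + 1) ≤ Real.exp (f δ) := by
    intro δ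
    have := Real.add_one_le_exp (f δ - m)
    calc Real.exp m * (f δ - m + 1) ≤ Real.exp m * Real.exp (f δ - m) :=
          mul_le_mul_of_nonneg_left this (Real.exp_pos _).le
      _ = Real.exp (f δ) := by rw [← Real.exp_add]; congr 1; ring
  refine le_trans (le_of_eq ?_) (Finset.sum_le_sum fun δ _ => h1 δ)
  rw [← Finset.mul_sum, Finset.sum_add_distrib, Finset.sum_sub_distrib, h]
  simp
  ring

/-- Main decoupling: a uniform bound for all masks gives a bound for the full form. -/
lemma decouple {n : ℕ} (A : Matrix (Fin n) (Fin n) ℝ) (K : ℝ)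
    (hK : ∀ δ, ∑ b : Fin n → Bool, Real.exp (8 * q ((mask δ A).mulVec (sv b)))
      ≤ 2 ^ n * Real.exp K) :
    ∑ b : Fin n → Bool, Real.exp (quad A (sv b)) ≤ 2 ^ n * Real.exp (A.trace + K) := by
  have hp : (0 : ℝ) < 2 ^ n := by positivity
  have h1 : 2 ^ n * ∑ b : Fin n → Bool, Real.exp (quad A (sv b) - A.trace)
      ≤ 2 ^ n * (2 ^ n * Real.exp K) := by
    calc 2 ^ n * ∑ b : Fin n → Bool, Real.exp (quad A (sv b) - A.trace)
        ≤ ∑ b : Fin n → Bool, ∑ δ : Fin n → Bool, Real.exp (4 * quad (mask δ A) (sv b)) := by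
          rw [Finset.mul_sum]
          exact Finset.sum_le_sum fun b _ => jensen _ _ (quad_avg A b)
      _ = ∑ δ : Fin n → Bool, ∑ b : Fin n → Bool, Real.exp (4 * quad (mask δ A) (sv b)) :=
          Finset.sum_comm
      _ ≤ ∑ _δ : Fin n → Bool, 2 ^ n * Real.exp K :=
          Finset.sum_le_sum fun δ _ => (decouple_fixed A δ).trans (hK δ)
      _ = 2 ^ n * (2 ^ n * Real.exp K) := by simp
  have h2 := le_of_mul_le_mul_left h1 hp
  have h3 : ∑ b : Fin n → Bool, Real.exp (quad A (sv b))
      = Real.exp A.trace * ∑ b : Fin n → Bool, Real.exp (quad A (sv b) - A.trace) := by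
    rw [Finset.mul_sum]
    refine Finset.sum_congr rfl fun b _ => ?_
    rw [← Real.exp_add]; congr 1; ring
  rw [h3, Real.exp_add]
  have := mul_le_mul_of_nonneg_left h2 (Real.exp_pos A.trace).le
  linarith

lemma q_sv {n : ℕ} (b : Fin n → Bool) : q (sv b) = n := by
  simp [q, sv, sq, sg_sq]

lemma q_mulVec_le {n : ℕ} (M : Matrix (Fin n) (Fin n) ℝ) (x : Fin n → ℝ) :
    q (M.mulVec x) ≤ fr M * q x := by
  unfold fr q
  rw [Finset.sum_mul]
  exact Finset.sum_le_sum fun i _ =>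
    Finset.sum_mul_sq_le_sq_mul_sq Finset.univ (fun j => M i j) x

lemma psd_step {n : ℕ} (k : ℕ) : ∀ M : Matrix (Fin n) (Fin n) ℝ, OpB M (1 / 128) →
    ∑ b : Fin n → Bool, Real.exp (8 * q (M.mulVec (sv b)))
      ≤ 2 ^ n * Real.exp ((16 + 8 * n * (1 / 2) ^ k) * fr M) := by
  induction k with
  | zero =>
    intro M _
    have : ∀ b ∈ (Finset.univ : Finset (Fin n → Bool)),
        Real.exp (8 * q (M.mulVec (sv b))) ≤ Real.exp ((16 + 8 * n * (1 / 2) ^ 0) * fr M) := by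
      intro b _
      refine Real.exp_le_exp.mpr ?_
      have := q_mulVec_le M (sv b)
      rw [q_sv] at this
      have := fr_nonneg M
      nlinarith
    refine (Finset.sum_le_sum this).trans (le_of_eq ?_)
    simp
  | succ k ih =>
    intro M hM
    have h := decouple (gram M) ((16 + 8 * n * (1 / 2) ^ k) * (1 / 2 * fr M)) ?_
    · simp only [quad_gram, trace_gram] at h
      refine h.trans (le_of_eq ?_)
      congr 2
      ring
    · intro δ
      have hop : OpB (mask δ (gram M)) (1 / 128) := by
        have h1 := (hM.gram (by norm_num)).mask (by norm_num) δ
        intro x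
        refine (h1 x).trans ?_
        have := q_nonneg x
        nlinarith
      refine (ih _ hop).trans ?_
      have hf : fr (mask δ (gram M)) ≤ 1 / 2 * fr M := by
        have h1 := fr_mask (gram M) δ
        have h2 := fr_gram hM
        linarith
      have hc : (0 : ℝ) ≤ 16 + 8 * n * (1 / 2) ^ k := by positivity
      exact mul_le_mul_of_nonneg_left
        (Real.exp_le_exp.mpr (mul_le_mul_of_nonneg_left hf hc)) (by positivity)

lemma psd {n : ℕ} (M : Matrix (Fin n) (Fin n) ℝ) (hM : OpB M (1 / 128)) :
    ∑ b : Fin n → Bool, Real.exp (8 * q (M.mulVec (sv b))) ≤ 2 ^ n * Real.exp (16 * fr M) := by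
  have ht : Filter.Tendsto (fun k : ℕ => (2 : ℝ) ^ n *
      Real.exp ((16 + 8 * n * (1 / 2) ^ k) * fr M)) Filter.atTop
      (nhds (2 ^ n * Real.exp ((16 + 8 * n * 0) * fr M))) := by
    have h0 : Filter.Tendsto (fun k : ℕ => ((1 : ℝ) / 2) ^ k) Filter.atTop (nhds 0) :=
      tendsto_pow_atTop_nhds_zero_of_lt_one (by norm_num) (by norm_num)
    exact ((Real.continuous_exp.tendsto _).comp
      (((h0.const_mul _).const_add _).mul_const _)).const_mul _
  have := ge_of_tendsto' ht (fun k => psd_step k M hM)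
  simpa using this

lemma chaos_mgf {n : ℕ} (A : Matrix (Fin n) (Fin n) ℝ) (hA : OpB A (1 / 128))
    (htr : A.trace = 0) :
    ∑ b : Fin n → Bool, Real.exp (quad A (sv b)) ≤ 2 ^ n * Real.exp (16 * fr A) := by
  have h := decouple A (16 * fr A) fun δ => by
    refine (psd _ (hA.mask (by norm_num) δ)).trans ?_
    have := fr_mask A δ
    gcongr
  rwa [htr, zero_add] at h

lemma OpB_spec {n : ℕ} (A : Matrix (Fin n) (Fin n) ℝ) : OpB A (specNorm A ^ 2) := by
  intro x
  have h := (LinearMap.toContinuousLinearMap (Matrix.toEuclideanLin A)).le_opNorm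
    (WithLp.toLp 2 x)
  have h2 := pow_le_pow_left₀ (norm_nonneg _) h 2
  rw [mul_pow, EuclideanSpace.norm_sq_eq, EuclideanSpace.norm_sq_eq] at h2
  simpa [q, specNorm] using h2

lemma fr_smul {n : ℕ} (s : ℝ) (A : Matrix (Fin n) (Fin n) ℝ) : fr (s • A) = s ^ 2 * fr A := by
  simp [fr, Finset.mul_sum, mul_pow]

lemma quad_smul {n : ℕ} (s : ℝ) (A : Matrix (Fin n) (Fin n) ℝ) (x : Fin n → ℝ) :
    quad (s • A) x = s * quad A x := by
  simp only [quad, Finset.mul_sum, Matrix.smul_apply, smul_eq_mul]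
  exact Finset.sum_congr rfl fun i _ => Finset.sum_congr rfl fun j _ => by ring

lemma chaos_mgf_s {n : ℕ} (A : Matrix (Fin n) (Fin n) ℝ) (htr : A.trace = 0) (s : ℝ)
    (hs : s ^ 2 * specNorm A ^ 2 ≤ 1 / 128) :
    ∑ b : Fin n → Bool, Real.exp (s * quad A (sv b))
      ≤ 2 ^ n * Real.exp (16 * (s ^ 2 * fr A)) := by
  have h := chaos_mgf (s • A) (fun x => by
    rw [Matrix.smul_mulVec, q_smul]
    have h1 := mul_le_mul_of_nonneg_left (OpB_spec A x) (sq_nonneg s)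
    have h2 := mul_le_mul_of_nonneg_right hs (q_nonneg x)
    linarith) (by rw [Matrix.trace_smul, htr, smul_zero])
  simpa only [quad_smul, fr_smul] using h

end Chaos

open Classical in
/-- **Tail bound for a trace-free Rademacher chaos.**
There is a universal constant `C > 0` such that for every symmetric `A ∈ ℝ^{n×n}` with
`tr A = 0`, every `t > 0`, every integer `l ≥ 2`, and `σ` uniform on `{-1,+1}^n`,
`P(|σᵀ A σ| > t) ≤ t^{-l} · C^l · max(√l ‖A‖_F, l ‖A‖₂)^l`.
The probability over the uniform sign vector `σ` is written as the proportion of the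
`2^n` assignments `b : Fin n → Bool` (with `σ i = if b i then 1 else -1`) realising the event. -/
theorem chaos_tail_bound :
    ∃ C : ℝ, 0 < C ∧
      ∀ (n : ℕ), 0 < n → ∀ (A : Matrix (Fin n) (Fin n) ℝ), A.IsSymm →
        Matrix.trace A = 0 →
          ∀ (t : ℝ), 0 < t → ∀ (l : ℕ), 2 ≤ l →
            ((Finset.univ.filter fun b : Fin n → Bool =>
                t < |∑ i, ∑ j,
                  (if b i then (1 : ℝ) else -1) * A i j *
                    (if b j then (1 : ℝ) else -1)|).card : ℝ) / 2 ^ n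
              ≤ (t ^ l)⁻¹ * C ^ l *
                  (max (Real.sqrt l * frobNorm A) ((l : ℝ) * specNorm A)) ^ l := by
  refine ⟨72, by norm_num, ?_⟩
  intro n _ A _ htr t ht l hl
  have hquad : ∀ b : Fin n → Bool, (∑ i, ∑ j, (if b i then (1 : ℝ) else -1) * A i j *
      (if b j then (1 : ℝ) else -1)) = Chaos.quad A (Chaos.sv b) := fun b => rfl
  simp only [hquad]
  set m := max (Real.sqrt l * frobNorm A) ((l : ℝ) * specNorm A) with hm
  have hl0 : (0 : ℝ) < l := by exact_mod_cast (by omega : 0 < l)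
  have hF : frobNorm A ^ 2 = Chaos.fr A := Real.sq_sqrt (Chaos.fr_nonneg A)
  have hF0 : 0 ≤ frobNorm A := Real.sqrt_nonneg _
  have hS0 : 0 ≤ specNorm A := norm_nonneg _
  have hm1 : Real.sqrt l * frobNorm A ≤ m := le_max_left _ _
  have hm2 : (l : ℝ) * specNorm A ≤ m := le_max_right _ _
  have hm0 : 0 ≤ m := le_trans (by positivity) hm1
  have hp : (0 : ℝ) < 2 ^ n := by positivity
  have htl : 0 < t ^ l := by positivity
  rcases hm0.eq_or_lt with h0 | hmpos
  · have hfz : Chaos.fr A = 0 := by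
      have h1 : 0 < Real.sqrt l := Real.sqrt_pos.mpr hl0
      have h2 : frobNorm A = 0 := by nlinarith
      rw [← hF, h2]; norm_num
    have hA : ∀ i j, A i j = 0 := by
      intro i j
      have h1 := (Finset.sum_eq_zero_iff_of_nonneg
        (fun i _ => Finset.sum_nonneg fun j _ => sq_nonneg (A i j))).mp hfz i (Finset.mem_univ _)
      have h2 := (Finset.sum_eq_zero_iff_of_nonneg
        (fun j _ => sq_nonneg (A i j))).mp h1 j (Finset.mem_univ _)
      exact pow_eq_zero_iff (two_ne_zero) |>.mp h2
    have hq : ∀ b, Chaos.quad A (Chaos.sv b) = 0 := by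
      intro b
      simp [Chaos.quad, hA]
    have : (Finset.univ.filter fun b : Fin n → Bool => t < |Chaos.quad A (Chaos.sv b)|) = ∅ := by
      refine Finset.filter_eq_empty_iff.mpr fun b _ => ?_
      rw [hq, abs_zero]
      exact not_lt.mpr ht.le
    rw [this]
    simp only [Finset.card_empty, Nat.cast_zero, zero_div]
    positivity
  · set s : ℝ := l / (12 * m) with hs
    have hspos : 0 < s := by positivity
    have hsm : s * (12 * m) = l := by rw [hs]; field_simp
    have hsS : s ^ 2 * specNorm A ^ 2 ≤ 1 / 128 := by
      have h1 : s * specNorm A ≤ 1 / 12 := by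
        rw [hs, div_mul_eq_mul_div, div_le_div_iff₀ (by positivity) (by norm_num)]
        linarith
      have h2 : 0 ≤ s * specNorm A := by positivity
      rw [← mul_pow]
      nlinarith
    have hsF : 16 * (s ^ 2 * Chaos.fr A) ≤ l := by
      have h1 : l * Chaos.fr A ≤ m ^ 2 := by
        have := pow_le_pow_left₀ (by positivity) hm1 2
        rwa [mul_pow, Real.sq_sqrt hl0.le, hF] at this
      have h2 : s ^ 2 * (144 * m ^ 2) = l ^ 2 := by rw [← hsm]; ring
      have h3 := mul_le_mul_of_nonneg_left h1 (sq_nonneg s)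
      have h4 : 144 * (s ^ 2 * Chaos.fr A) * l ≤ l * l := by nlinarith
      have h5 := le_of_mul_le_mul_right h4 hl0
      have h6 : 0 ≤ s ^ 2 * Chaos.fr A := mul_nonneg (sq_nonneg s) (Chaos.fr_nonneg A)
      linarith
    have hE1 := Chaos.chaos_mgf_s A htr s hsS
    have hE2 := Chaos.chaos_mgf_s A htr (-s) (by rwa [neg_sq])
    rw [neg_sq] at hE2
    set S := Finset.univ.filter fun b : Fin n → Bool => t < |Chaos.quad A (Chaos.sv b)| with hSdef
    have hpt : ∀ b ∈ S, t ^ l ≤ (12 * m) ^ l * (Real.exp (s * Chaos.quad A (Chaos.sv b))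
        + Real.exp (-s * Chaos.quad A (Chaos.sv b))) := by
      intro b hb
      have hb' : t < |Chaos.quad A (Chaos.sv b)| := (Finset.mem_filter.mp hb).2
      set X := Chaos.quad A (Chaos.sv b) with hX
      have h1 : |X| ≤ 12 * m * Real.exp (s * |X| / l) := by
        have h2 := Real.add_one_le_exp (s * |X| / l)
        have h3 : |X| = 12 * m * (s * |X| / l) := by
          rw [← hsm]; field_simp
        calc |X| = 12 * m * (s * |X| / l) := h3
          _ ≤ 12 * m * Real.exp (s * |X| / l) := by
            refine mul_le_mul_of_nonneg_left ?_ (by positivity)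
            linarith
      have h4 : t ^ l ≤ (12 * m * Real.exp (s * |X| / l)) ^ l :=
        pow_le_pow_left₀ ht.le (hb'.le.trans h1) l
      rw [mul_pow, ← Real.exp_nat_mul, mul_div_cancel₀ _ hl0.ne'] at h4
      refine h4.trans (mul_le_mul_of_nonneg_left ?_ (by positivity))
      rcases abs_choice X with h | h <;> rw [h]
      · linarith [Real.exp_pos (-s * X)]
      · rw [mul_neg, ← neg_mul]
        linarith [Real.exp_pos (s * X)]
    have hcount : (S.card : ℝ) * t ^ l ≤ (12 * m) ^ l * (2 * (2 ^ n * Real.exp l)) := by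
      have hexp : Real.exp (16 * (s ^ 2 * Chaos.fr A)) ≤ Real.exp l := Real.exp_le_exp.mpr hsF
      have hexp2 := mul_le_mul_of_nonneg_left hexp hp.le
      calc (S.card : ℝ) * t ^ l = ∑ _b ∈ S, t ^ l := by simp
        _ ≤ ∑ b ∈ S, (12 * m) ^ l * (Real.exp (s * Chaos.quad A (Chaos.sv b))
            + Real.exp (-s * Chaos.quad A (Chaos.sv b))) := Finset.sum_le_sum hpt
        _ ≤ ∑ b, (12 * m) ^ l * (Real.exp (s * Chaos.quad A (Chaos.sv b))
            + Real.exp (-s * Chaos.quad A (Chaos.sv b))) :=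
          Finset.sum_le_sum_of_subset_of_nonneg (Finset.subset_univ _)
            (fun b _ _ => by positivity)
        _ ≤ (12 * m) ^ l * (2 * (2 ^ n * Real.exp l)) := by
          rw [← Finset.mul_sum, Finset.sum_add_distrib]
          refine mul_le_mul_of_nonneg_left ?_ (by positivity)
          linarith
    have he : 2 * Real.exp l ≤ 6 ^ l := by
      have h1 : Real.exp l ≤ 3 ^ l := by
        have : Real.exp l = Real.exp 1 ^ l := by rw [← Real.exp_nat_mul, mul_one]
        rw [this]
        exact pow_le_pow_left₀ (Real.exp_pos _).le (by linarith [Real.exp_one_lt_d9]) l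
      have h2 : (2 : ℝ) ≤ 2 ^ l := by
        calc (2 : ℝ) = 2 ^ 1 := by norm_num
          _ ≤ 2 ^ l := pow_le_pow_right₀ (by norm_num) (by omega)
      calc 2 * Real.exp l ≤ 2 ^ l * 3 ^ l :=
            mul_le_mul h2 h1 (Real.exp_pos _).le (by positivity)
        _ = 6 ^ l := by rw [← mul_pow]; norm_num
    have hfin : (S.card : ℝ) * t ^ l ≤ 72 ^ l * m ^ l * 2 ^ n := by
      refine hcount.trans ?_
      have h72 : (72 : ℝ) ^ l * m ^ l = (12 * m) ^ l * 6 ^ l := by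
        rw [← mul_pow, ← mul_pow]; congr 1; ring
      rw [h72]
      have h1 := mul_le_mul_of_nonneg_left he
        (by positivity : (0 : ℝ) ≤ (12 * m) ^ l * 2 ^ n)
      linarith
    rw [div_le_iff₀ hp, mul_assoc, mul_assoc, ← div_eq_inv_mul, le_div_iff₀ htl, ← mul_assoc]
    exact hfin
end

section
/- (Johnson–Lindenstrauss Lemma) There exists an absolute constant C > 0 such that for all real numbers 0 < ε < 1/2 and 0 < δ < 1/2 and every positive integer n, setting d = ⌈C ε^{-2} log₂(1/δ)⌉, there exists a probability measure 𝒟 on the space of d × n real matrices such that for every fixed x ∈ ℝⁿ, the 𝒟-probability of the set of matrices R satisfying (1−ε)‖x‖₂ ≤ ‖Rx‖₂ ≤ (1+ε)‖x‖₂ is greater than 1 − δ. -/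
open MeasureTheory ProbabilityTheory
open scoped NNReal

lemma jl_scalar {u : ℝ} (h : |u| ≤ 1/2) : (1 - u)⁻¹ ≤ Real.exp (u + u^2) := by
  have h1 := (abs_le.mp h).1
  have h2 := (abs_le.mp h).2
  have hp : 0 < 1 - u := by linarith
  rw [inv_le_iff_one_le_mul₀ hp]
  rcases le_total u 0 with hu | hu
  · have := Real.add_one_le_exp (u + u^2)
    have h3 : 0 ≤ -u^3 := by
      have := pow_nonneg (neg_nonneg.2 hu) 3
      nlinarith
    nlinarith
  · have := Real.quadratic_le_exp_of_nonneg (x := u + u^2) (by positivity)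
    have h3 : (1 + (u+u^2) + (u+u^2)^2/2) * (1-u) ≤ Real.exp (u+u^2) * (1-u) := by gcongr
    refine le_trans ?_ h3
    have h4 : 0 ≤ (1-u)*(1+u)^2/2 - u := by nlinarith
    have := mul_nonneg (sq_nonneg u) h4
    nlinarith

lemma jl_gauss_integrand {v : ℝ≥0} (hv : v ≠ 0) (a : ℝ) (y : ℝ) :
    gaussianPDFReal 0 v y * Real.exp (a / v * y^2) =
      (√(2 * Real.pi * v))⁻¹ * Real.exp (- ((1 - 2 * a) / (2 * v)) * y^2) := by
  have : (v:ℝ) ≠ 0 := by exact_mod_cast hv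
  rw [gaussianPDFReal, mul_assoc, ← Real.exp_add]
  congr 2
  field_simp
  ring

lemma jl_gauss_integrable {v : ℝ≥0} (hv : v ≠ 0) {a : ℝ} (ha : |a| ≤ 1/4) :
    Integrable (fun y => Real.exp (a / v * y^2)) (gaussianReal 0 v) := by
  have hv' : (0:ℝ) < v := by positivity
  have h2 := (abs_le.mp ha).2
  rw [gaussianReal_of_var_ne_zero _ hv,
    integrable_withDensity_iff_integrable_smul' (measurable_gaussianPDF _ _)
      (ae_of_all _ fun _ => gaussianPDF_lt_top)]
  simp_rw [toReal_gaussianPDF, smul_eq_mul, jl_gauss_integrand hv]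
  exact (integrable_exp_neg_mul_sq (div_pos (by linarith) (by linarith))).const_mul _

lemma jl_gauss_integral {v : ℝ≥0} (hv : v ≠ 0) {a : ℝ} (ha : |a| ≤ 1/4) :
    ∫ y, Real.exp (a / v * y^2) ∂(gaussianReal 0 v) ≤ Real.exp (a + 2 * a^2) := by
  have hv' : (0:ℝ) < v := by positivity
  have h2 := (abs_le.mp ha).2
  rw [integral_gaussianReal_eq_integral_smul hv]
  simp_rw [smul_eq_mul, jl_gauss_integrand hv]
  rw [integral_const_mul, integral_gaussian, ← Real.sqrt_inv, ← Real.sqrt_mul (by positivity)]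
  have h1 : (2 * Real.pi * (v:ℝ))⁻¹ * (Real.pi / ((1 - 2 * a) / (2 * v))) = (1 - 2 * a)⁻¹ := by
    have := Real.pi_ne_zero
    have : 1 - 2 * a ≠ 0 := by linarith
    field_simp
  rw [h1]
  apply Real.sqrt_le_iff.2 ⟨(Real.exp_pos _).le, ?_⟩
  have := jl_scalar (u := 2 * a) (by rw [abs_mul, abs_two]; linarith)
  refine this.trans (le_of_eq ?_)
  rw [← Real.exp_nat_mul]
  congr 1
  push_cast; ring

lemma jl_law {n : ℕ} (v : ℝ≥0) (x : Fin n → ℝ) (w : ℝ≥0) (hw : (w:ℝ) = v * ∑ i, x i ^ 2) :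
    (Measure.pi (fun _ : Fin n => gaussianReal 0 v)).map (fun y => ∑ i, y i * x i) =
      gaussianReal 0 w := by
  have hm : Measurable (fun y : Fin n → ℝ => ∑ i, y i * x i) := by fun_prop
  have : IsProbabilityMeasure ((Measure.pi (fun _ : Fin n => gaussianReal 0 v)).map
    (fun y => ∑ i, y i * x i)) := Measure.isProbabilityMeasure_map hm.aemeasurable
  apply Measure.ext_of_charFun
  ext u
  rw [charFun_apply_real, integral_map hm.aemeasurable (by fun_prop), charFun_gaussianReal]
  have : ∀ y : Fin n → ℝ, Complex.exp (u * ((∑ i, y i * x i : ℝ) : ℂ) * Complex.I) =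
      ∏ i, Complex.exp (((u * x i : ℝ) : ℂ) * (y i : ℂ) * Complex.I) := by
    intro y
    rw [← Complex.exp_sum]
    congr 1
    push_cast
    rw [Finset.mul_sum, Finset.sum_mul]
    refine Finset.sum_congr rfl fun i _ => by ring
  simp_rw [this]
  rw [integral_fintype_prod_eq_prod
    (f := fun i (z : ℝ) => Complex.exp (((u * x i : ℝ) : ℂ) * (z : ℂ) * Complex.I))]
  simp_rw [← charFun_apply_real, charFun_gaussianReal]
  rw [← Complex.exp_sum]
  congr 1
  have : (w : ℂ) = v * ∑ i, (x i : ℂ) ^ 2 := by exact_mod_cast congrArg (fun r : ℝ => (r : ℂ)) hw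
  rw [this]
  push_cast
  simp only [Finset.mul_sum, Finset.sum_mul, Finset.sum_div, mul_zero, zero_mul, zero_sub]
  rw [← Finset.sum_neg_distrib]
  refine Finset.sum_congr rfl fun i _ => by ring

lemma jl_mgf {d : ℕ} {v : ℝ≥0} (hv : v ≠ 0) {a : ℝ} (ha : |a| ≤ 1/4) :
    Integrable (fun y : Fin d → ℝ => Real.exp (a / v * ∑ t, y t ^ 2))
      (Measure.pi (fun _ : Fin d => gaussianReal 0 v)) ∧
    mgf (fun y : Fin d → ℝ => ∑ t, y t ^ 2) (Measure.pi (fun _ : Fin d => gaussianReal 0 v))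
      (a / v) ≤ Real.exp (d * (a + 2 * a^2)) := by
  have h : ∀ y : Fin d → ℝ, Real.exp (a / v * ∑ t, y t ^ 2) =
      ∏ t, Real.exp (a / v * y t ^ 2) := by
    intro y
    rw [← Real.exp_sum, Finset.mul_sum]
  constructor
  · simp_rw [h]
    exact Integrable.fintype_prod (f := fun (_ : Fin d) (z : ℝ) => Real.exp (a / v * z ^ 2))
      fun _ => jl_gauss_integrable hv ha
  · rw [mgf]
    simp_rw [h]
    rw [integral_fintype_prod_eq_prod
      (f := fun (_ : Fin d) (z : ℝ) => Real.exp (a / v * z ^ 2))]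
    rw [Finset.prod_const, Finset.card_univ, Fintype.card_fin, Real.exp_nat_mul]
    exact pow_le_pow_left₀ (integral_nonneg fun _ => (Real.exp_pos _).le)
      (jl_gauss_integral hv ha) d

/-- The two-sided tail bound for a chi-square sum with `v = s / d`. -/
lemma jl_tail {d : ℕ} {v : ℝ≥0} (hv : v ≠ 0) {ε : ℝ} (h0 : 0 < ε) (h1 : ε < 1/2) :
    (Measure.pi (fun _ : Fin d => gaussianReal 0 v)).real
      {y | (1 + ε)^2 * (v * d) ≤ ∑ t, y t ^ 2} ≤ Real.exp (-(ε^2 * d / 4)) ∧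
    (Measure.pi (fun _ : Fin d => gaussianReal 0 v)).real
      {y | ∑ t, y t ^ 2 ≤ (1 - ε)^2 * (v * d)} ≤ Real.exp (-(ε^2 * d / 4)) := by
  have hv' : (0:ℝ) < v := by positivity
  have hd : (0:ℝ) ≤ d := by positivity
  constructor
  · have ha : |ε/2| ≤ 1/4 := by rw [abs_of_pos (by positivity)]; linarith
    obtain ⟨hi, hm⟩ := jl_mgf (d := d) hv ha
    refine (measure_ge_le_exp_mul_mgf _ (by positivity) hi).trans ?_
    refine (mul_le_mul_of_nonneg_left hm (Real.exp_pos _).le).trans ?_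
    rw [← Real.exp_add, Real.exp_le_exp]
    have : -(ε / 2 / (v:ℝ)) * ((1 + ε) ^ 2 * (v * d)) = -(ε/2) * (1+ε)^2 * d := by field_simp
    rw [this]
    have : 0 ≤ (d:ℝ) * (ε^2/4 + ε^3/2) := by positivity
    nlinarith
  · have ha : |-(ε/2)| ≤ 1/4 := by rw [abs_neg, abs_of_pos (by positivity)]; linarith
    obtain ⟨hi, hm⟩ := jl_mgf (d := d) hv ha
    refine (measure_le_le_exp_mul_mgf _
      (div_nonpos_of_nonpos_of_nonneg (by linarith) hv'.le) hi).trans ?_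
    refine (mul_le_mul_of_nonneg_left hm (Real.exp_pos _).le).trans ?_
    rw [← Real.exp_add, Real.exp_le_exp]
    have : -(-(ε / 2) / (v:ℝ)) * ((1 - ε) ^ 2 * (v * d)) = (ε/2) * (1-ε)^2 * d := by field_simp
    rw [this]
    have : 0 ≤ (d:ℝ) * (ε^2 * (1/2 - ε)) := by
      have : 0 < 1/2 - ε := by linarith
      positivity
    nlinarith

/-- **Johnson–Lindenstrauss Lemma.**
There is an absolute constant `C > 0` such that for all `0 < ε < 1/2`, `0 < δ < 1/2`
and every positive integer `n`, setting `d = ⌈C ε⁻² log₂(1/δ)⌉`, there is a probability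
measure `𝒟` on `d × n` real matrices (modelled as `Fin d → Fin n → ℝ` with its Borel
σ-algebra) such that for every fixed `x ∈ ℝⁿ`, the `𝒟`-probability of the set of
matrices `R` with `(1-ε)‖x‖₂ ≤ ‖Rx‖₂ ≤ (1+ε)‖x‖₂` is greater than `1 - δ`. -/
theorem johnson_lindenstrauss :
    ∃ C : ℝ, 0 < C ∧
      ∀ (ε δ : ℝ), 0 < ε → ε < 1 / 2 → 0 < δ → δ < 1 / 2 → ∀ (n : ℕ), 0 < n →
        ∃ 𝒟 : Measure (Fin ⌈C * ε⁻¹ ^ 2 * Real.logb 2 (1 / δ)⌉₊ → Fin n → ℝ),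
          IsProbabilityMeasure 𝒟 ∧
            ∀ x : Fin n → ℝ,
              𝒟 {R | (1 - ε) * Real.sqrt (∑ i, x i ^ 2) ≤
                        Real.sqrt (∑ t, (∑ i, R t i * x i) ^ 2) ∧
                      Real.sqrt (∑ t, (∑ i, R t i * x i) ^ 2) ≤
                        (1 + ε) * Real.sqrt (∑ i, x i ^ 2)}
                > ENNReal.ofReal (1 - δ) := by
  refine ⟨12, by norm_num, ?_⟩
  intro ε δ hε hε' hδ hδ' n _
  have hL : Real.log (1 / δ) ≤ Real.logb 2 (1 / δ) := by
    rw [Real.logb, le_div_iff₀ (Real.log_pos (by norm_num))]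
    have h2 : Real.log 2 ≤ 1 := by linarith [Real.log_two_lt_d9]
    have h3 : 0 ≤ Real.log (1 / δ) := Real.log_nonneg (by rw [le_div_iff₀ hδ]; linarith)
    nlinarith
  have hLpos : 0 < Real.log (1 / δ) := Real.log_pos (by rw [lt_div_iff₀ hδ]; linarith)
  have hceil := Nat.le_ceil (12 * ε⁻¹ ^ 2 * Real.logb 2 (1 / δ))
  generalize ⌈12 * ε⁻¹ ^ 2 * Real.logb 2 (1 / δ)⌉₊ = d at hceil ⊢
  have hdL : 3 * Real.log (1 / δ) ≤ ε^2 * d / 4 := by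
    have : ε^2 * (12 * ε⁻¹ ^ 2 * Real.logb 2 (1 / δ)) ≤ ε^2 * d := by gcongr
    have e : ε^2 * (12 * ε⁻¹ ^ 2 * Real.logb 2 (1 / δ)) = 12 * Real.logb 2 (1 / δ) := by
      field_simp
    linarith
  have hd : (0:ℝ) < d := by
    by_contra hcon
    have : (d:ℝ) = 0 := le_antisymm (not_lt.1 hcon) (by positivity)
    rw [this] at hdL
    linarith
  have hexp : Real.exp (-(ε^2 * d / 4)) ≤ δ^3 := by
    have : δ^3 = Real.exp (-(3 * Real.log (1 / δ))) := by
      rw [one_div, Real.log_inv, mul_neg, neg_neg,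
        show (3:ℝ) * Real.log δ = ((3:ℕ):ℝ) * Real.log δ by norm_num, Real.exp_nat_mul,
        Real.exp_log hδ]
    rw [this, Real.exp_le_exp]
    linarith
  have hδ3 : 2 * δ^3 < δ := by nlinarith [mul_pos hδ hδ]
  let v : ℝ≥0 := (d : ℝ≥0)⁻¹
  refine ⟨Measure.pi fun _ => Measure.pi fun _ => gaussianReal 0 v, inferInstance, ?_⟩
  intro x
  by_cases hx : ∑ i, x i ^ 2 = 0
  · have hx0 : ∀ i, x i = 0 := by
      intro i
      have := (Finset.sum_eq_zero_iff_of_nonneg (fun i _ => sq_nonneg (x i))).1 hx i (Finset.mem_univ i)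
      exact pow_eq_zero_iff two_ne_zero |>.1 this
    simp [hx0, hδ]
  have hs : 0 < ∑ i, x i ^ 2 := lt_of_le_of_ne (Finset.sum_nonneg fun i _ => sq_nonneg _) (Ne.symm hx)
  set s := ∑ i, x i ^ 2 with hsdef
  let w : ℝ≥0 := v * ⟨s, hs.le⟩
  have hw : (w:ℝ) = v * s := rfl
  have hv0 : v ≠ 0 := by
    simp only [v, ne_eq, inv_eq_zero]
    exact_mod_cast hd.ne'
  have hw0 : w ≠ 0 := by
    rw [← NNReal.coe_ne_zero, hw]
    exact mul_ne_zero (by exact_mod_cast hv0) hs.ne'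
  have hwd : (w:ℝ) * d = s := by
    rw [hw]; simp only [v]; push_cast; field_simp
  have hmf : Measurable (fun (R : Fin d → Fin n → ℝ) t => ∑ i, R t i * x i) := by fun_prop
  have hmap : (Measure.pi fun _ : Fin d => Measure.pi fun _ : Fin n => gaussianReal 0 v).map
      (fun R t => ∑ i, R t i * x i) = Measure.pi fun _ : Fin d => gaussianReal 0 w := by
    rw [← jl_law v x w hw]
    have hm1 : Measurable (fun y : Fin n → ℝ => ∑ i, y i * x i) := by fun_prop
    have : IsProbabilityMeasure ((Measure.pi (fun _ : Fin n => gaussianReal 0 v)).map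
      (fun y => ∑ i, y i * x i)) := Measure.isProbabilityMeasure_map hm1.aemeasurable
    exact Measure.pi_map_pi (μ := fun _ : Fin d => Measure.pi fun _ : Fin n => gaussianReal 0 v)
      (f := fun _ (y : Fin n → ℝ) => ∑ i, y i * x i) (fun _ => hm1.aemeasurable)
  let A : Set (Fin d → ℝ) := {y | (1 - ε) * √s ≤ √(∑ t, y t ^ 2) ∧ √(∑ t, y t ^ 2) ≤ (1 + ε) * √s}
  have hA : MeasurableSet A := by
    have hmT : Measurable (fun y : Fin d → ℝ => √(∑ t, y t ^ 2)) := by fun_prop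
    exact (measurableSet_le measurable_const hmT).inter (measurableSet_le hmT measurable_const)
  change (Measure.pi fun _ : Fin d => Measure.pi fun _ : Fin n => gaussianReal 0 v)
    ((fun R t => ∑ i, R t i * x i) ⁻¹' A) > _
  rw [← Measure.map_apply hmf hA, hmap]
  obtain ⟨hu, hl⟩ := jl_tail (d := d) hw0 hε hε'
  rw [hwd] at hu hl
  set ν := Measure.pi fun _ : Fin d => gaussianReal 0 w
  have hsub : Aᶜ ⊆ {y | (1 + ε)^2 * s ≤ ∑ t, y t ^ 2} ∪ {y | ∑ t, y t ^ 2 ≤ (1 - ε)^2 * s} := by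
    intro y hy
    by_contra hcon
    simp only [Set.mem_union, Set.mem_ofPred_eq, not_or, not_le] at hcon
    apply hy
    constructor
    · apply Real.le_sqrt_of_sq_le
      rw [mul_pow, Real.sq_sqrt hs.le]; exact hcon.2.le
    · apply Real.sqrt_le_iff.2 ⟨by positivity, ?_⟩
      rw [mul_pow, Real.sq_sqrt hs.le]; exact hcon.1.le
  have hcompl : ν.real Aᶜ < δ := by
    have := (measureReal_mono (μ := ν) hsub).trans (measureReal_union_le _ _)
    linarith
  rw [probReal_compl_eq_one_sub hA] at hcompl
  rw [gt_iff_lt, ENNReal.ofReal_lt_iff_lt_toReal (by linarith) (measure_ne_top _ _)]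
  change _ < ν.real A
  linarith
end
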